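/- If (μ, ν, σ) is a regular triple of standard Weyl pairs, then there exists a unique linear map R : V_{(μ,ν)} ⊗ V_{(μν,σ)} → V_{(μ,νσ)} ⊗ V_{(ν,σ)} (Kashaev's 6j-symbol) such that for all f ∈ V_{(μ,ν)}, g ∈ V_{(μν,σ)} and w ∈ ℂ^N, writing R(f ⊗ g) = Σ_i f_i ⊗ g_i, one has Σ_i (Id_{ℂ^N}⊗g_i)(f_i(w)) = (f⊗Id_{ℂ^N})(g(w)) in ℂ^N⊗ℂ^N⊗ℂ^N; moreover R is a linear isomorphism. -/

import Mathlib

open TensorProduct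

noncomputable section

/-- ℂ^N: functions from ℤ/Nℤ to ℂ. -/
abbrev CN (N : ℕ) := ZMod N → ℂ

/-- The operator A with A e_k = q^{2k} e_k. -/
def opA (q : ℂ) (N : ℕ) : Module.End ℂ (CN N) where
  toFun f := fun k => q ^ (2 * k.val) * f k
  map_add' f g := by funext k; simp [mul_add]
  map_smul' c f := by funext k; simp [smul_eq_mul]; ring

/-- The operator B with B e_k = e_{k+1}. -/
def opB (N : ℕ) : Module.End ℂ (CN N) where
  toFun f := fun k => f (k - 1)
  map_add' f g := by funext k; simp
  map_smul' c f := by funext k; simp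

/-- The operator C with C e_k = q^{1-2k} e_{k-1}, i.e. (C f)(k) = q^{-1-2k} f(k+1). -/
def opC (q : ℂ) (N : ℕ) : Module.End ℂ (CN N) where
  toFun f := fun k => q ^ (-1 - 2 * (k.val : ℤ)) * f (k + 1)
  map_add' f g := by funext k; simp [mul_add]
  map_smul' c f := by funext k; simp [smul_eq_mul]; ring

/-- A Weyl pair: invertible endomorphisms with X Y = q² Y X. -/
def IsWeylPair (q : ℂ) {V : Type*} [AddCommMonoid V] [Module ℂ V]
    (X Y : Module.End ℂ V) : Prop :=
  IsUnit X ∧ IsUnit Y ∧ X * Y = q ^ 2 • (Y * X)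

/-- A subspace invariant under both X and Y. -/
def WeylInvariant {V : Type*} [AddCommMonoid V] [Module ℂ V]
    (X Y : Module.End ℂ V) (W : Submodule ℂ V) : Prop :=
  (∀ v ∈ W, X v ∈ W) ∧ (∀ v ∈ W, Y v ∈ W)

/-- An irreducible Weyl pair. -/
def IsIrreducibleWeylPair (q : ℂ) {V : Type*} [AddCommMonoid V] [Module ℂ V]
    (X Y : Module.End ℂ V) : Prop :=
  IsWeylPair q X Y ∧ Nontrivial V ∧
    ∀ W : Submodule ℂ V, WeylInvariant X Y W → W = ⊥ ∨ W = ⊤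
/-- The Clebsch–Gordan space of a pair of Weyl pairs: all linear maps
f : ℂ^N → ℂ^N ⊗ ℂ^N with f∘X_{αβ} = (X_α⊗X_β)∘f and
f∘Y_{αβ} = (X_α⁻¹⊗Y_β + Y_α⊗Id)∘f. -/
def CGsub (N : ℕ) (Xa Ya Xb Yb Xab Yab : Module.End ℂ (CN N)) :
    Submodule ℂ (CN N →ₗ[ℂ] (CN N ⊗[ℂ] CN N)) where
  carrier := {f | f ∘ₗ Xab = (TensorProduct.map Xa Xb) ∘ₗ f ∧
    f ∘ₗ Yab = (TensorProduct.map (Ring.inverse Xa) Yb + TensorProduct.map Ya 1) ∘ₗ f}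
  add_mem' := by
    rintro f g ⟨hf1, hf2⟩ ⟨hg1, hg2⟩
    constructor <;> simp only [LinearMap.add_comp, LinearMap.comp_add, hf1, hf2, hg1, hg2]
  zero_mem' := by constructor <;> simp
  smul_mem' := by
    rintro c f ⟨hf1, hf2⟩
    constructor <;> simp only [LinearMap.smul_comp, LinearMap.comp_smul, hf1, hf2]

/-- The space of linear maps ℂ^N → ℂ^N ⊗ ℂ^N ⊗ ℂ^N intertwining the Weyl pair
(Xp, Yp) with the triple tensor operators of (Xμ,Yμ), (Xν,Yν), (Xσ,Yσ). -/
def CG3sub (N : ℕ) (Xμ Yμ Xν Yν Xσ Yσ Xp Yp : Module.End ℂ (CN N)) :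
    Submodule ℂ (CN N →ₗ[ℂ] (CN N ⊗[ℂ] (CN N ⊗[ℂ] CN N))) where
  carrier := {F | F ∘ₗ Xp = (TensorProduct.map Xμ (TensorProduct.map Xν Xσ)) ∘ₗ F ∧
    F ∘ₗ Yp = (TensorProduct.map (Ring.inverse Xμ) (TensorProduct.map (Ring.inverse Xν) Yσ)
      + TensorProduct.map (Ring.inverse Xμ) (TensorProduct.map Yν 1)
      + TensorProduct.map Yμ 1) ∘ₗ F}
  add_mem' := by
    rintro f g ⟨hf1, hf2⟩ ⟨hg1, hg2⟩
    constructor <;> simp only [LinearMap.add_comp, LinearMap.comp_add, hf1, hf2, hg1, hg2]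
  zero_mem' := by constructor <;> simp
  smul_mem' := by
    rintro c f ⟨hf1, hf2⟩
    constructor <;> simp only [LinearMap.smul_comp, LinearMap.comp_smul, hf1, hf2]

/-- The bilinear map (f, g) ↦ assoc ∘ (f ⊗ Id) ∘ g, f ⊗ g acting as
w ↦ (f ⊗ Id_{ℂ^N})(g(w)) ∈ ℂ^N ⊗ ℂ^N ⊗ ℂ^N. -/
def phiRaw (N : ℕ) :
    (CN N →ₗ[ℂ] CN N ⊗[ℂ] CN N) →ₗ[ℂ] (CN N →ₗ[ℂ] CN N ⊗[ℂ] CN N) →ₗ[ℂ]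
      (CN N →ₗ[ℂ] CN N ⊗[ℂ] (CN N ⊗[ℂ] CN N)) :=
  LinearMap.mk₂ ℂ
    (fun f g => (TensorProduct.assoc ℂ (CN N) (CN N) (CN N)).toLinearMap ∘ₗ
      (TensorProduct.map f LinearMap.id) ∘ₗ g)
    (fun f f' g => by
      simp only [TensorProduct.map_add_left, LinearMap.add_comp, LinearMap.comp_add])
    (fun c f g => by
      simp only [TensorProduct.map_smul_left, LinearMap.smul_comp, LinearMap.comp_smul])
    (fun f g g' => by
      simp only [LinearMap.comp_add])
    (fun c f g => by
      simp only [LinearMap.comp_smul])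

/-- The bilinear map (f, g) ↦ (Id ⊗ g) ∘ f, f ⊗ g acting as
w ↦ (Id_{ℂ^N} ⊗ g)(f(w)) ∈ ℂ^N ⊗ ℂ^N ⊗ ℂ^N. -/
def psiRaw (N : ℕ) :
    (CN N →ₗ[ℂ] CN N ⊗[ℂ] CN N) →ₗ[ℂ] (CN N →ₗ[ℂ] CN N ⊗[ℂ] CN N) →ₗ[ℂ]
      (CN N →ₗ[ℂ] CN N ⊗[ℂ] (CN N ⊗[ℂ] CN N)) :=
  LinearMap.mk₂ ℂ
    (fun f g => (TensorProduct.map LinearMap.id g) ∘ₗ f)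
    (fun f f' g => by simp only [LinearMap.comp_add])
    (fun c f g => by simp only [LinearMap.comp_smul])
    (fun f g g' => by
      simp only [TensorProduct.map_add_right, LinearMap.add_comp])
    (fun c f g => by
      simp only [TensorProduct.map_smul_right, LinearMap.smul_comp])

/-- The linear map V_{(μ,ν)} ⊗ V_{(μν,σ)} → Hom(ℂ^N, ℂ^N⊗ℂ^N⊗ℂ^N),
f ⊗ g ↦ (f⊗Id)∘g. -/
def phiL (N : ℕ) (CG1 CG2 : Submodule ℂ (CN N →ₗ[ℂ] CN N ⊗[ℂ] CN N)) :
    (CG1 ⊗[ℂ] CG2) →ₗ[ℂ] (CN N →ₗ[ℂ] CN N ⊗[ℂ] (CN N ⊗[ℂ] CN N)) :=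
  TensorProduct.lift (((phiRaw N).comp CG1.subtype).compl₂ CG2.subtype)

/-- The linear map V_{(μ,νσ)} ⊗ V_{(ν,σ)} → Hom(ℂ^N, ℂ^N⊗ℂ^N⊗ℂ^N),
f ⊗ g ↦ (Id⊗g)∘f. -/
def psiL (N : ℕ) (CG1 CG2 : Submodule ℂ (CN N →ₗ[ℂ] CN N ⊗[ℂ] CN N)) :
    (CG1 ⊗[ℂ] CG2) →ₗ[ℂ] (CN N →ₗ[ℂ] CN N ⊗[ℂ] (CN N ⊗[ℂ] CN N)) :=
  TensorProduct.lift (((psiRaw N).comp CG1.subtype).compl₂ CG2.subtype)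

/-- Gaussian binomial coefficients. -/
def qb (ω : ℂ) : ℕ → ℕ → ℂ
  | _, 0 => 1
  | 0, _ + 1 => 0
  | n + 1, k + 1 => qb ω n k + ω ^ (k + 1) * qb ω n (k + 1)

theorem qb_zero_right (ω : ℂ) (n : ℕ) : qb ω n 0 = 1 := by
  cases n <;> simp [qb]

theorem qb_of_lt (ω : ℂ) : ∀ n k : ℕ, n < k → qb ω n k = 0
  | 0, k + 1, _ => by simp [qb]
  | n + 1, k + 1, h => by
    rw [qb, qb_of_lt ω n k (by omega), qb_of_lt ω n (k + 1) (by omega)]; simp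

theorem qb_self (ω : ℂ) : ∀ n : ℕ, qb ω n n = 1
  | 0 => by simp [qb]
  | n + 1 => by
    rw [qb, qb_self ω n, qb_of_lt ω n (n + 1) (by omega)]; simp

theorem qb_rec (ω : ℂ) : ∀ n k m : ℕ, k + m = n →
    (1 - ω ^ (k + 1)) * qb ω n (k + 1) = (1 - ω ^ m) * qb ω n k := by
  intro n
  induction n with
  | zero =>
    intro k m h
    obtain ⟨rfl, rfl⟩ : k = 0 ∧ m = 0 := by omega
    simp [qb]
  | succ n ih =>
    intro k m h
    rcases m with _ | m
    · rw [qb_of_lt ω (n + 1) (k + 1) (by omega)]; simp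
    · have h1 := ih k m (by omega)
      rw [qb]
      rcases k with _ | k
      · obtain rfl : m = n := by omega
        rw [qb_zero_right] at *
        rw [qb_zero_right]
        linear_combination ω ^ (0 + 1) * h1
      · have h2 := ih k (m + 1) (by omega)
        rw [show qb ω (n + 1) (k + 1) = qb ω n k + ω ^ (k + 1) * qb ω n (k + 1) from by rw [qb]]
        linear_combination ω ^ (k + 1 + 1) * h1 + h2

theorem qb_root {N : ℕ} {ω : ℂ} (hω : IsPrimitiveRoot ω N) :
    ∀ k : ℕ, k + 1 < N → qb ω N (k + 1) = 0 := by
  intro k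
  induction k with
  | zero =>
    intro h
    have h1 := qb_rec ω N 0 N (by omega)
    rw [hω.pow_eq_one] at h1
    have h2 := hω.pow_ne_one_of_pos_of_lt (l := 0 + 1) (by omega) h
    simp only [sub_self, zero_mul, mul_eq_zero] at h1
    exact h1.resolve_left (sub_ne_zero.2 h2.symm)
  | succ k ih =>
    intro h
    have h1 := qb_rec ω N (k + 1) (N - (k + 1)) (by omega)
    rw [ih (by omega)] at h1
    have h2 := hω.pow_ne_one_of_pos_of_lt (l := k + 1 + 1) (by omega) h
    simp only [mul_zero, mul_eq_zero] at h1
    exact h1.resolve_left (sub_ne_zero.2 h2.symm)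

theorem qcomm_pow {R : Type*} [Ring R] [Algebra ℂ R] (ω : ℂ) (P Q : R)
    (h : Q * P = ω • (P * Q)) (k : ℕ) : Q * P ^ k = ω ^ k • (P ^ k * Q) := by
  induction k with
  | zero => simp
  | succ k ih =>
    rw [pow_succ, ← mul_assoc, ih, smul_mul_assoc, mul_assoc, h, mul_smul_comm, smul_smul,
      ← mul_assoc, pow_succ]

theorem qbinom_exp {R : Type*} [Ring R] [Algebra ℂ R] (ω : ℂ) (P Q : R)
    (h : Q * P = ω • (P * Q)) (n : ℕ) :
    (P + Q) ^ n = ∑ k ∈ Finset.range (n + 1), qb ω n k • (P ^ k * Q ^ (n - k)) := by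
  induction n with
  | zero => simp [qb]
  | succ n ih =>
    rw [pow_succ', ih, add_mul, Finset.sum_range_succ' _ (n + 1)]
    have e1 : P * ∑ k ∈ Finset.range (n + 1), qb ω n k • (P ^ k * Q ^ (n - k))
        = ∑ k ∈ Finset.range (n + 1), qb ω n k • (P ^ (k + 1) * Q ^ (n - k)) := by
      rw [Finset.mul_sum]
      refine Finset.sum_congr rfl fun k _ => ?_
      rw [mul_smul_comm, ← mul_assoc, pow_succ']
    have e2 : Q * ∑ k ∈ Finset.range (n + 1), qb ω n k • (P ^ k * Q ^ (n - k))
        = ∑ k ∈ Finset.range (n + 1 + 1), (ω ^ k * qb ω n k) • (P ^ k * Q ^ (n + 1 - k)) := by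
      rw [Finset.sum_range_succ _ (n + 1), qb_of_lt ω n (n + 1) (by omega), mul_zero, zero_smul,
        add_zero, Finset.mul_sum]
      refine Finset.sum_congr rfl fun k hk => ?_
      have hk' : k ≤ n := by simpa [Nat.lt_succ_iff] using hk
      rw [mul_smul_comm, ← mul_assoc, qcomm_pow ω P Q h, smul_mul_assoc, smul_smul, mul_assoc,
        ← pow_succ', mul_comm (qb ω n k), Nat.succ_sub hk']
    rw [e1, e2, Finset.sum_range_succ' _ (n + 1), ← add_assoc, ← Finset.sum_add_distrib]
    congr 1
    · refine Finset.sum_congr rfl fun k _ => ?_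
      rw [qb, add_smul, Nat.succ_sub_succ]
    · simp [qb_zero_right]

theorem qbinom_root {R : Type*} [Ring R] [Algebra ℂ R] {N : ℕ} (hN : 1 ≤ N) {ω : ℂ}
    (hω : IsPrimitiveRoot ω N) (P Q : R) (h : Q * P = ω • (P * Q)) :
    (P + Q) ^ N = P ^ N + Q ^ N := by
  rw [qbinom_exp ω P Q h, Finset.sum_range_succ, qb_self]
  obtain ⟨M, rfl⟩ : ∃ M, N = M + 1 := ⟨N - 1, by omega⟩
  rw [Finset.sum_range_succ', Finset.sum_eq_zero]
  · simp [qb_zero_right, add_comm]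
  · intro k hk
    rw [qb_root hω k (by simpa using hk), zero_smul]

/-- Intertwiners from a pair of operators on `CN N` to a pair on `V`. -/
def HW {V : Type*} [AddCommGroup V] [Module ℂ V] (N : ℕ) (X0 Y0 : Module.End ℂ (CN N))
    (X Y : Module.End ℂ V) : Submodule ℂ (CN N →ₗ[ℂ] V) where
  carrier := {f | f ∘ₗ X0 = X ∘ₗ f ∧ f ∘ₗ Y0 = Y ∘ₗ f}
  add_mem' := by
    rintro f g ⟨hf1, hf2⟩ ⟨hg1, hg2⟩
    constructor <;> simp only [LinearMap.add_comp, LinearMap.comp_add, hf1, hf2, hg1, hg2]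
  zero_mem' := by constructor <;> simp
  smul_mem' := by
    rintro c f ⟨hf1, hf2⟩
    constructor <;> simp only [LinearMap.smul_comp, LinearMap.comp_smul, hf1, hf2]

/-- Algebraic relations of a cyclic Weyl pair. -/
structure WD {R : Type*} [Ring R] [Algebra ℂ R] (N : ℕ) (ω x y : ℂ) (X Y : R) : Prop where
  comm : X * Y = ω • (Y * X)
  powX : X ^ N = x • (1 : R)
  powY : Y ^ N = y • (1 : R)

theorem WD.isUnit {R : Type*} [Ring R] [Algebra ℂ R] {N : ℕ} (hN : 1 ≤ N) {ω x y : ℂ} {X Y : R}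
    (h : WD N ω x y X Y) (hx : x ≠ 0) : IsUnit X := by
  have h1 : IsUnit (X ^ N) := by
    rw [h.powX, ← Algebra.algebraMap_eq_smul_one]
    exact (IsUnit.mk0 x hx).map (algebraMap ℂ R)
  exact (isUnit_pow_iff (by omega)).1 h1

theorem WD.tensor {V W : Type*} [AddCommGroup V] [Module ℂ V] [AddCommGroup W] [Module ℂ W]
    {N : ℕ} (hN : 1 ≤ N) {ω : ℂ} (hω : IsPrimitiveRoot ω N) {xa ya xb yb : ℂ} (hxa : xa ≠ 0)
    {Xa Ya : Module.End ℂ V} {Xb Yb : Module.End ℂ W}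
    (ha : WD N ω xa ya Xa Ya) (hb : WD N ω xb yb Xb Yb) :
    WD N ω (xa * xb) (xa⁻¹ * yb + ya) (R := Module.End ℂ (V ⊗[ℂ] W)) (TensorProduct.map Xa Xb)
      (TensorProduct.map (Ring.inverse Xa) Yb + TensorProduct.map Ya 1) := by
  have hu := ha.isUnit hN hxa
  have i1 := Ring.mul_inverse_cancel _ hu
  have i2 := Ring.inverse_mul_cancel _ hu
  set I := Ring.inverse Xa with hI
  have hpI : I ^ N = xa⁻¹ • (1 : Module.End ℂ V) := by
    have hc : Commute I Xa := by rw [Commute, SemiconjBy, i1, i2]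
    have : I ^ N * Xa ^ N = 1 := by rw [← hc.mul_pow, i2, one_pow]
    rw [ha.powX, mul_smul_comm, mul_one] at this
    rw [← this, smul_smul, inv_mul_cancel₀ hxa, one_smul]
  have hcI : Ya * I = ω • (I * Ya) := by
    calc Ya * I = I * (Xa * Ya) * I := by rw [← mul_assoc, i2, one_mul]
      _ = ω • (I * Ya * (Xa * I)) := by
        rw [ha.comm, mul_smul_comm, smul_mul_assoc]; simp only [mul_assoc]
      _ = _ := by rw [i1, mul_one]
  refine ⟨?_, ?_, ?_⟩
  · rw [mul_add, add_mul, smul_add]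
    simp only [← TensorProduct.map_mul]
    rw [hb.comm, ha.comm, i1, i2, TensorProduct.map_smul_left, TensorProduct.map_smul_right,
      mul_one, one_mul]
  · rw [TensorProduct.map_pow, ha.powX, hb.powX, TensorProduct.map_smul_left,
      TensorProduct.map_smul_right, TensorProduct.map_one, smul_smul]
  · rw [qbinom_root hN hω, TensorProduct.map_pow, TensorProduct.map_pow, hpI, hb.powY, ha.powY,
      one_pow, TensorProduct.map_smul_left, TensorProduct.map_smul_right,
      TensorProduct.map_smul_left, TensorProduct.map_one, smul_smul, add_smul]
    simp only [← TensorProduct.map_mul]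
    rw [hcI, TensorProduct.map_smul_left, mul_one, one_mul]

theorem zpow_val_add {M : Type*} [Monoid M] {N : ℕ} [NeZero N] {a : M} (ha : a ^ N = 1)
    (x y : ZMod N) : a ^ (x + y).val = a ^ x.val * a ^ y.val := by
  rw [ZMod.val_add, ← pow_add, ← pow_eq_pow_mod _ ha]

theorem zpow_val_succ {M : Type*} [Monoid M] {N : ℕ} [NeZero N] {a : M} (ha : a ^ N = 1)
    (x : ZMod N) : a ^ (x + 1).val = a * a ^ x.val := by
  have h : ((1 : ZMod N)).val = 1 % N := ZMod.val_one_eq_one_mod N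
  rw [add_comm, zpow_val_add ha, h, ← pow_eq_pow_mod _ ha, pow_one]

theorem opA_apply' (q : ℂ) (N : ℕ) (f : CN N) (k : ZMod N) :
    opA q N f k = (q ^ 2) ^ k.val * f k := by
  rw [← pow_mul]; rfl

theorem opA_single (q : ℂ) (N : ℕ) (k : ZMod N) :
    opA q N (Pi.single k 1) = (q ^ 2) ^ k.val • (Pi.single k 1 : CN N) := by
  funext l
  rw [opA_apply']
  by_cases h : l = k
  · subst h; simp
  · simp [h]

theorem opB_single (N : ℕ) (k : ZMod N) :
    opB N (Pi.single k 1) = (Pi.single (k + 1) 1 : CN N) := by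
  funext l
  change (Pi.single k 1 : CN N) (l - 1) = _
  simp only [Pi.single_apply, sub_eq_iff_eq_add]

theorem std_WD {N : ℕ} [NeZero N] {q : ℂ} (hq : IsPrimitiveRoot (q ^ 2) N) (u v : ℂ) :
    WD N (q ^ 2) (u ^ N) (v ^ N) (u • opA q N) (v • opB N) := by
  have e1 : opA q N * opB N = q ^ 2 • (opB N * opA q N) := by
    refine LinearMap.pi_ext' fun k => LinearMap.ext_ring ?_
    simp only [LinearMap.comp_apply, LinearMap.single_apply, Module.End.mul_apply,
      LinearMap.smul_apply, opA_single, opB_single, map_smul, smul_smul]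
    rw [zpow_val_succ hq.pow_eq_one]
  have e2 : (opA q N) ^ N = 1 := by
    refine LinearMap.pi_ext' fun k => LinearMap.ext_ring ?_
    have : ∀ n : ℕ, ((opA q N) ^ n) (Pi.single k 1)
        = ((q ^ 2) ^ k.val) ^ n • (Pi.single k 1 : CN N) := by
      intro n
      induction n with
      | zero => simp
      | succ n ih => rw [pow_succ', Module.End.mul_apply, ih, map_smul, opA_single, smul_smul,
          pow_succ ((q ^ 2) ^ k.val)]
    simp only [LinearMap.comp_apply, LinearMap.single_apply, this]
    rw [← pow_mul, mul_comm, pow_mul, hq.pow_eq_one]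
    simp
  have e3 : (opB N) ^ N = 1 := by
    refine LinearMap.pi_ext' fun k => LinearMap.ext_ring ?_
    have : ∀ n : ℕ, ((opB N) ^ n) (Pi.single k 1) = (Pi.single (k + n) 1 : CN N) := by
      intro n
      induction n with
      | zero => simp
      | succ n ih => rw [pow_succ', Module.End.mul_apply, ih, opB_single]; simp [add_assoc]
    simp only [LinearMap.comp_apply, LinearMap.single_apply, this]
    simp
  refine ⟨?_, ?_, ?_⟩
  · simp only [smul_mul_assoc, mul_smul_comm, e1, smul_smul]
    congr 1; ring
  · rw [smul_pow, e2]
  · rw [smul_pow, e3]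

theorem HW_single_X {V : Type*} [AddCommGroup V] [Module ℂ V] {N : ℕ} {q u v : ℂ}
    {X Y : Module.End ℂ V} {f : CN N →ₗ[ℂ] V}
    (hf : f ∈ HW N (u • opA q N) (v • opB N) X Y) (k : ZMod N) :
    X (f (Pi.single k 1)) = (u * (q ^ 2) ^ k.val) • f (Pi.single k 1) := by
  have := LinearMap.congr_fun hf.1 (Pi.single k 1)
  simp only [LinearMap.comp_apply, LinearMap.smul_apply, opA_single, map_smul, smul_smul] at this
  exact this.symm

theorem HW_single_Y {V : Type*} [AddCommGroup V] [Module ℂ V] {N : ℕ} {q u v : ℂ}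
    {X Y : Module.End ℂ V} {f : CN N →ₗ[ℂ] V}
    (hf : f ∈ HW N (u • opA q N) (v • opB N) X Y) (k : ZMod N) :
    Y (f (Pi.single k 1)) = v • f (Pi.single (k + 1) 1) := by
  have := LinearMap.congr_fun hf.2 (Pi.single k 1)
  simp only [LinearMap.comp_apply, LinearMap.smul_apply, opB_single, map_smul] at this
  exact this.symm

theorem HW_eq_zero {V : Type*} [AddCommGroup V] [Module ℂ V] {N : ℕ} [NeZero N] {q u v : ℂ}
    (hv : v ≠ 0) {X Y : Module.End ℂ V} {f : CN N →ₗ[ℂ] V}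
    (hf : f ∈ HW N (u • opA q N) (v • opB N) X Y) (k : ZMod N)
    (h : f (Pi.single k 1) = 0) : f = 0 := by
  have h1 : ∀ n : ℕ, f (Pi.single (k + n) 1) = 0 := by
    intro n
    induction n with
    | zero => simpa using h
    | succ n ih =>
      have := HW_single_Y hf (k + n)
      rw [ih, map_zero] at this
      have h2 := (smul_eq_zero.1 this.symm).resolve_left hv
      rwa [Nat.cast_succ, ← add_assoc]
  refine LinearMap.pi_ext' fun l => LinearMap.ext_ring ?_
  have := h1 (l - k).val
  rw [ZMod.natCast_zmod_val, add_sub_cancel] at this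
  simpa using this

/-- Evaluation at the basis vector 0. -/
def ev0 {V : Type*} [AddCommGroup V] [Module ℂ V] {N : ℕ} (S : Submodule ℂ (CN N →ₗ[ℂ] V)) :
    S →ₗ[ℂ] V := (LinearMap.applyₗ (Pi.single 0 1 : CN N)) ∘ₗ S.subtype

theorem ev0_inj {V : Type*} [AddCommGroup V] [Module ℂ V] {N : ℕ} [NeZero N] {q u v : ℂ}
    (hv : v ≠ 0) {X Y : Module.End ℂ V} :
    Function.Injective (ev0 (HW N (u • opA q N) (v • opB N) X Y)) := by
  rw [← LinearMap.ker_eq_bot, LinearMap.ker_eq_bot']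
  rintro ⟨f, hf⟩ h
  exact Subtype.ext (HW_eq_zero hv hf 0 h)

/-- Evaluation map. -/
def ev {V : Type*} [AddCommGroup V] [Module ℂ V] {N : ℕ} (S : Submodule ℂ (CN N →ₗ[ℂ] V)) :
    S ⊗[ℂ] CN N →ₗ[ℂ] V := TensorProduct.lift S.subtype

theorem ev_inj_of {V : Type*} [AddCommGroup V] [Module ℂ V] {N : ℕ}
    (S : Submodule ℂ (CN N →ₗ[ℂ] V)) (h : ∀ t, ev S t = 0 → t = 0) :
    Function.Injective (ev S) := by
  intro a b hab
  have h1 : a + (-1 : ℂ) • b = 0 := h _ (by rw [map_add, map_smul, hab]; simp)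
  have h2 : (-1 : ℂ) • b + b = 0 := by
    conv_lhs => rw [← one_smul ℂ b, smul_smul, ← add_smul]
    simp
  calc a = a + ((-1 : ℂ) • b + b) := by rw [h2, add_zero]
    _ = b := by rw [← add_assoc, h1, zero_add]

theorem ev_inj {V : Type*} [AddCommGroup V] [Module ℂ V] {N : ℕ} [NeZero N] {q u v : ℂ}
    (hq : IsPrimitiveRoot (q ^ 2) N) (hu : u ≠ 0) (hv : v ≠ 0) {X Y : Module.End ℂ V} :
    Function.Injective (ev (HW N (u • opA q N) (v • opB N) X Y)) := by
  refine ev_inj_of _ ?_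
  intro t ht
  have hex : ∃ h : ZMod N → HW N (u • opA q N) (v • opB N) X Y,
      t = ∑ k, h k ⊗ₜ[ℂ] (Pi.single k 1 : CN N) := by
    clear ht
    induction t using TensorProduct.induction_on with
    | zero => exact ⟨0, by simp⟩
    | tmul f w =>
      refine ⟨fun k => w k • f, ?_⟩
      simp only [TensorProduct.smul_tmul, ← TensorProduct.tmul_sum]
      congr 1
      funext l
      simp [Finset.sum_apply, Pi.single_apply]
    | add a b ha hb =>
      obtain ⟨h, rfl⟩ := ha
      obtain ⟨h', rfl⟩ := hb
      exact ⟨h + h', by simp [TensorProduct.add_tmul, Finset.sum_add_distrib]⟩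
  obtain ⟨h, rfl⟩ := hex
  have hs : ∑ k, (h k : CN N →ₗ[ℂ] V) (Pi.single k 1) = 0 := by
    simpa [ev] using ht
  have hinj : Function.Injective (fun k : ZMod N => u * (q ^ 2) ^ k.val) := by
    intro a b hab
    exact ZMod.val_injective N
      (hq.pow_inj (ZMod.val_lt a) (ZMod.val_lt b) (mul_left_cancel₀ hu hab))
  have hind := (Module.End.eigenspaces_iSupIndep X).comp hinj
  rw [iSupIndep_iff_finsetSum_eq_zero_imp_eq_zero] at hind
  have hz := hind Finset.univ (fun k => (h k : CN N →ₗ[ℂ] V) (Pi.single k 1))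
    (fun k _ => Module.End.mem_eigenspace_iff.2 (HW_single_X (h k).2 k)) hs
  refine Finset.sum_eq_zero fun k hk => ?_
  have : h k = 0 := Subtype.ext (HW_eq_zero hv (h k).2 k (hz k hk))
  rw [this, TensorProduct.zero_tmul]

theorem HW_exists {V : Type*} [AddCommGroup V] [Module ℂ V] {N : ℕ} [NeZero N] {q u v : ℂ}
    (hq : IsPrimitiveRoot (q ^ 2) N) (hv : v ≠ 0) {X Y : Module.End ℂ V}
    (hW : WD N (q ^ 2) (u ^ N) (v ^ N) X Y) (k : ZMod N) (w : V)
    (hw : X w = (u * (q ^ 2) ^ k.val) • w) :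
    ∃ f ∈ HW N (u • opA q N) (v • opB N) X Y, f (Pi.single k 1) = w := by
  set Y' : Module.End ℂ V := v⁻¹ • Y with hY'
  have hYN : Y' ^ N = 1 := by
    rw [hY', smul_pow, hW.powY, smul_smul, ← mul_pow, inv_mul_cancel₀ hv, one_pow, one_smul]
  have hYY : Y = v • Y' := by rw [hY', smul_smul, mul_inv_cancel₀ hv, one_smul]
  have hc : X * Y' = q ^ 2 • (Y' * X) := by
    rw [hY', mul_smul_comm, smul_mul_assoc, hW.comm, smul_comm]
  have hcn : ∀ n : ℕ, X * Y' ^ n = (q ^ 2) ^ n • (Y' ^ n * X) := fun n => qcomm_pow _ _ _ hc n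
  let f : CN N →ₗ[ℂ] V :=
    ∑ l, (LinearMap.toSpanSingleton ℂ V ((Y' ^ (l - k).val) w)) ∘ₗ (LinearMap.proj l)
  have hf : ∀ l, f (Pi.single l 1) = (Y' ^ (l - k).val) w := by
    intro l
    simp [f, LinearMap.sum_apply, Pi.single_apply]
  refine ⟨f, ⟨?_, ?_⟩, ?_⟩
  · refine LinearMap.pi_ext' fun l => LinearMap.ext_ring ?_
    simp only [LinearMap.comp_apply, LinearMap.single_apply, LinearMap.smul_apply, opA_single,
      map_smul, hf, smul_smul]
    have := LinearMap.congr_fun (hcn (l - k).val) w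
    simp only [Module.End.mul_apply, LinearMap.smul_apply, hw, map_smul, smul_smul] at this
    rw [this]
    congr 1
    have h2 := zpow_val_add hq.pow_eq_one (l - k) k
    rw [sub_add_cancel] at h2
    rw [h2]; ring
  · refine LinearMap.pi_ext' fun l => LinearMap.ext_ring ?_
    simp only [LinearMap.comp_apply, LinearMap.single_apply, LinearMap.smul_apply, opB_single,
      map_smul, hf]
    rw [hYY, add_sub_right_comm, zpow_val_succ hYN]
    rfl
  · rw [hf]; simp

theorem ev_surj {V : Type*} [AddCommGroup V] [Module ℂ V] {N : ℕ} [NeZero N] {q u v : ℂ}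
    (hq : IsPrimitiveRoot (q ^ 2) N) (hu : u ≠ 0) (hv : v ≠ 0) {X Y : Module.End ℂ V}
    (hW : WD N (q ^ 2) (u ^ N) (v ^ N) X Y) :
    Function.Surjective (ev (HW N (u • opA q N) (v • opB N) X Y)) := by
  rw [← LinearMap.range_eq_top, eq_top_iff]
  rintro w -
  obtain ⟨ω, hω⟩ : ∃ ω, ω = q ^ 2 := ⟨_, rfl⟩
  have hq0 := hq
  have hW0 := hW
  rw [← hω] at hq hW
  have hN0 : N ≠ 0 := NeZero.ne N
  have hω0 : ω ≠ 0 := hq.ne_zero hN0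
  let Z : ℕ → Module.End ℂ V := fun k => (u * ω ^ k)⁻¹ • X
  have hZN : ∀ k, Z k ^ N = 1 := by
    intro k
    have : u ^ N * (ω ^ k) ^ N = u ^ N := by
      rw [← pow_mul, mul_comm k, pow_mul, hq.pow_eq_one, one_pow, mul_one]
    simp only [Z]
    rw [smul_pow, hW.powX, smul_smul, inv_pow, mul_pow, this, inv_mul_cancel₀ (pow_ne_zero _ hu),
      one_smul]
  let S : ℕ → Module.End ℂ V := fun k => ∑ j ∈ Finset.range N, Z k ^ j
  have hS : ∀ k, Z k * S k = S k := by
    intro k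
    have h1 := mul_geom_sum (Z k) N
    rw [hZN, sub_self, sub_mul, one_mul, sub_eq_zero] at h1
    exact h1
  have hXS : ∀ k, X (S k w) = (u * ω ^ k) • S k w := by
    intro k
    have h1 := LinearMap.congr_fun (hS k) w
    have h2 : X = (u * ω ^ k) • Z k := by
      simp only [Z]
      rw [smul_smul, mul_inv_cancel₀ (mul_ne_zero hu (pow_ne_zero _ hω0)), one_smul]
    conv_lhs => rw [h2]
    rw [LinearMap.smul_apply, ← Module.End.mul_apply, h1]
  have hmem : ∀ k ∈ Finset.range N,
      S k w ∈ LinearMap.range (ev (HW N (u • opA q N) (v • opB N) X Y)) := by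
    intro k hk
    have hk' : ((k : ZMod N)).val = k := ZMod.val_cast_of_lt (Finset.mem_range.1 hk)
    obtain ⟨f, hf, he⟩ := HW_exists hq0 hv hW0 (k : ZMod N) (S k w) (by rw [hk', ← hω]; exact hXS k)
    exact ⟨(⟨f, hf⟩ : HW N (u • opA q N) (v • opB N) X Y) ⊗ₜ Pi.single (k : ZMod N) 1, by
      simpa [ev] using he⟩
  have hsum : ∑ k ∈ Finset.range N, S k = (N : ℂ) • (1 : Module.End ℂ V) := by
    simp only [S]
    rw [Finset.sum_comm]
    have h1 : ∀ j ∈ Finset.range N, ∑ k ∈ Finset.range N, Z k ^ j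
        = if j = 0 then (N : ℂ) • (1 : Module.End ℂ V) else 0 := by
      intro j hj
      split_ifs with h0
      · subst h0
        simp [Nat.cast_smul_eq_nsmul]
      · have h2 : ∀ k, Z k ^ j = ((ω ^ j)⁻¹ ^ k) • ((u⁻¹) ^ j • X ^ j) := by
          intro k
          simp only [Z]
          rw [smul_pow, smul_smul]
          congr 1
          rw [mul_inv, mul_pow, mul_comm]
          congr 1
          rw [inv_pow, inv_pow, ← pow_mul, ← pow_mul, mul_comm]
        simp only [h2, ← Finset.sum_smul]
        have h3 := mul_geom_sum (ω ^ j)⁻¹ N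
        rw [inv_pow, ← pow_mul, mul_comm j, pow_mul, hq.pow_eq_one, one_pow, inv_one,
          sub_self] at h3
        have h4 : (ω ^ j)⁻¹ - 1 ≠ 0 := by
          rw [sub_ne_zero, ne_eq, inv_eq_one]
          exact hq.pow_ne_one_of_pos_of_lt h0 (Finset.mem_range.1 hj)
        rw [(mul_eq_zero.1 h3).resolve_left h4, zero_smul]
    rw [Finset.sum_congr rfl h1]
    simp [hN0]
  have hw : w = (N : ℂ)⁻¹ • ∑ k ∈ Finset.range N, S k w := by
    rw [← LinearMap.sum_apply, hsum, LinearMap.smul_apply, smul_smul,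
      inv_mul_cancel₀ (Nat.cast_ne_zero.2 hN0), one_smul]
    rfl
  rw [hw]
  exact Submodule.smul_mem _ _ (Submodule.sum_mem _ hmem)

theorem HW_finrank {V : Type*} [AddCommGroup V] [Module ℂ V] {N : ℕ} [NeZero N]
    {q u v : ℂ}
    (hq : IsPrimitiveRoot (q ^ 2) N) (hu : u ≠ 0) (hv : v ≠ 0) {X Y : Module.End ℂ V}
    (hW : WD N (q ^ 2) (u ^ N) (v ^ N) X Y) :
    Module.finrank ℂ (HW N (u • opA q N) (v • opB N) X Y) * N = Module.finrank ℂ V := by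
  rw [← (LinearEquiv.ofBijective _ ⟨ev_inj hq hu hv, ev_surj hq hu hv hW⟩).finrank_eq,
    Module.finrank_tensorProduct]
  simp [ZMod.card]

theorem flat_sub {V W : Type*} [AddCommGroup V] [Module ℂ V] [AddCommGroup W] [Module ℂ W]
    (S : Submodule ℂ (W →ₗ[ℂ] V)) : Module.Flat ℂ S := inferInstance

theorem finrank_sub_tensor {V W : Type*} [AddCommGroup V] [Module ℂ V] [AddCommGroup W]
    [Module ℂ W] (S T : Submodule ℂ (W →ₗ[ℂ] V)) :
    Module.finrank ℂ (S ⊗[ℂ] T) = Module.finrank ℂ S * Module.finrank ℂ T :=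
  Module.finrank_tensorProduct

theorem phi_inj {N : ℕ} (S T : Submodule ℂ (CN N →ₗ[ℂ] CN N ⊗[ℂ] CN N))
    (hS : Function.Injective (ev S)) (hT : Function.Injective (ev0 T)) :
    Function.Injective (phiL N S T) := by
  have hflS : Module.Flat ℂ S := flat_sub S
  have hflT : Module.Flat ℂ T := flat_sub T
  have key : (LinearMap.applyₗ (Pi.single 0 1 : CN N)) ∘ₗ phiL N S T
      = (TensorProduct.assoc ℂ (CN N) (CN N) (CN N)).toLinearMap ∘ₗ
        ((ev S).rTensor (CN N)) ∘ₗ (TensorProduct.assoc ℂ S (CN N) (CN N)).symm.toLinearMap ∘ₗ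
        ((ev0 T).lTensor S) := by
    refine TensorProduct.ext' fun f g => ?_
    simp only [LinearMap.comp_apply, phiL, TensorProduct.lift.tmul, LinearMap.compl₂_apply,
      LinearMap.applyₗ_apply_apply, phiRaw, LinearMap.mk₂_apply, LinearMap.lTensor_tmul,
      LinearEquiv.coe_coe, Submodule.subtype_apply]
    congr 1
    change _ = (LinearMap.rTensor (CN N) (ev S))
      ((TensorProduct.assoc ℂ S (CN N) (CN N)).symm (f ⊗ₜ[ℂ] (g.1 (Pi.single 0 1))))
    generalize g.1 (Pi.single 0 1) = z
    induction z using TensorProduct.induction_on with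
    | zero => simp
    | tmul a b => simp [ev]
    | add a b ha hb => simp only [TensorProduct.tmul_add, map_add, ha, hb]
  refine Function.Injective.of_comp
    (f := (LinearMap.applyₗ (Pi.single 0 1 : CN N) : (CN N →ₗ[ℂ] CN N ⊗[ℂ] (CN N ⊗[ℂ] CN N)) →ₗ[ℂ] _)) ?_
  rw [← LinearMap.coe_comp, key]
  simp only [LinearMap.coe_comp, LinearEquiv.coe_coe]
  exact (LinearEquiv.injective _).comp
    ((Module.Flat.rTensor_preserves_injective_linearMap _ hS).comp
      ((LinearEquiv.injective _).comp (Module.Flat.lTensor_preserves_injective_linearMap _ hT)))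

theorem psi_inj {N : ℕ} (S T : Submodule ℂ (CN N →ₗ[ℂ] CN N ⊗[ℂ] CN N))
    (hS : Function.Injective (ev0 S)) (hT : Function.Injective (ev T)) :
    Function.Injective (psiL N S T) := by
  have hflS : Module.Flat ℂ S := flat_sub S
  have hflT : Module.Flat ℂ T := flat_sub T
  have key : (LinearMap.applyₗ (Pi.single 0 1 : CN N)) ∘ₗ psiL N S T
      = ((ev T).lTensor (CN N)) ∘ₗ
        ((TensorProduct.comm ℂ (CN N) T).toLinearMap.lTensor (CN N)) ∘ₗ
        (TensorProduct.assoc ℂ (CN N) (CN N) T).toLinearMap ∘ₗ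
        ((ev0 S).rTensor T) := by
    refine TensorProduct.ext' fun f g => ?_
    simp only [LinearMap.comp_apply, psiL, TensorProduct.lift.tmul, LinearMap.compl₂_apply,
      LinearMap.applyₗ_apply_apply, psiRaw, LinearMap.mk₂_apply, LinearMap.rTensor_tmul,
      LinearEquiv.coe_coe, Submodule.subtype_apply]
    change _ = (LinearMap.lTensor (CN N) (ev T))
      ((LinearMap.lTensor (CN N) (TensorProduct.comm ℂ (CN N) T).toLinearMap)
      ((TensorProduct.assoc ℂ (CN N) (CN N) T) ((f.1 (Pi.single 0 1)) ⊗ₜ[ℂ] g)))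
    generalize f.1 (Pi.single 0 1) = z
    induction z using TensorProduct.induction_on with
    | zero => simp
    | tmul a b => simp [ev]
    | add a b ha hb => simp only [TensorProduct.add_tmul, map_add, ha, hb]
  refine Function.Injective.of_comp
    (f := (LinearMap.applyₗ (Pi.single 0 1 : CN N) : (CN N →ₗ[ℂ] CN N ⊗[ℂ] (CN N ⊗[ℂ] CN N)) →ₗ[ℂ] _)) ?_
  rw [← LinearMap.coe_comp, key]
  simp only [LinearMap.coe_comp, LinearEquiv.coe_coe]
  exact (Module.Flat.lTensor_preserves_injective_linearMap _ hT).comp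
    ((Module.Flat.lTensor_preserves_injective_linearMap _ (LinearEquiv.injective _)).comp
      ((LinearEquiv.injective _).comp (Module.Flat.rTensor_preserves_injective_linearMap _ hS)))

theorem range_eq_of {N : ℕ} {E : Type*} [AddCommMonoid E] [Module ℂ E]
    {V : Type*} [AddCommGroup V] [Module ℂ V] [FiniteDimensional ℂ V]
    (φ : E →ₗ[ℂ] (CN N →ₗ[ℂ] V)) (S : Submodule ℂ (CN N →ₗ[ℂ] V)) [NeZero N]
    (hφ : Function.Injective φ) (hle : LinearMap.range φ ≤ S)
    (hd : Module.finrank ℂ E = Module.finrank ℂ S) : LinearMap.range φ = S :=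
  Submodule.eq_of_le_of_finrank_eq hle ((LinearMap.finrank_range_of_inj hφ).trans hd)

theorem exists_R {E E' F : Type*} [AddCommMonoid E] [Module ℂ E] [AddCommMonoid E'] [Module ℂ E']
    [AddCommMonoid F] [Module ℂ F] (φ : E →ₗ[ℂ] F) (ψ : E' →ₗ[ℂ] F)
    (hφ : Function.Injective φ) (hψ : Function.Injective ψ)
    (h : LinearMap.range φ = LinearMap.range ψ) :
    ∃ R : E →ₗ[ℂ] E', ψ ∘ₗ R = φ ∧ Function.Bijective R ∧
      ∀ R' : E →ₗ[ℂ] E', ψ ∘ₗ R' = φ → R' = R := by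
  let e : E ≃ₗ[ℂ] E' := LinearEquiv.ofInjective φ hφ ≪≫ₗ LinearEquiv.ofEq _ _ h ≪≫ₗ
    (LinearEquiv.ofInjective ψ hψ).symm
  have he : ψ ∘ₗ e.toLinearMap = φ := by
    ext x
    have : (LinearEquiv.ofInjective ψ hψ) (e x)
        = LinearEquiv.ofEq _ _ h (LinearEquiv.ofInjective φ hφ x) := by
      simp [e]
    exact congrArg Subtype.val this
  refine ⟨e.toLinearMap, he, e.bijective, fun R' hR' => ?_⟩
  ext x
  apply hψ
  exact (LinearMap.congr_fun hR' x).trans (LinearMap.congr_fun he x).symm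

theorem psi_range_le (N : ℕ) (X1 Y1 X2 Y2 X3 Y3 X23 Y23 X Y : Module.End ℂ (CN N)) :
    LinearMap.range (psiL N (CGsub N X1 Y1 X23 Y23 X Y) (CGsub N X2 Y2 X3 Y3 X23 Y23)) ≤
    HW N X Y (TensorProduct.map X1 (TensorProduct.map X2 X3))
      (TensorProduct.map (Ring.inverse X1)
        (TensorProduct.map (Ring.inverse X2) Y3 + TensorProduct.map Y2 1)
        + TensorProduct.map Y1 1) := by
  rintro _ ⟨t, rfl⟩
  induction t using TensorProduct.induction_on with
  | zero => rw [map_zero]; exact Submodule.zero_mem _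
  | add a b ha hb => rw [map_add]; exact Submodule.add_mem _ ha hb
  | tmul f g =>
    obtain ⟨f, hf1, hf2⟩ := f
    obtain ⟨g, hg1, hg2⟩ := g
    change (TensorProduct.map LinearMap.id g) ∘ₗ f ∈ _
    constructor
    · rw [LinearMap.comp_assoc, hf1, ← LinearMap.comp_assoc, ← LinearMap.comp_assoc,
        ← TensorProduct.map_comp, ← TensorProduct.map_comp, hg1]
      rfl
    · rw [LinearMap.comp_assoc, hf2, ← LinearMap.comp_assoc, ← LinearMap.comp_assoc,
        LinearMap.comp_add, LinearMap.add_comp (TensorProduct.map LinearMap.id g)]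
      simp only [← TensorProduct.map_comp]
      rw [hg2]
      rfl

theorem phi_range_le (N : ℕ) (X1 Y1 X2 Y2 X3 Y3 X12 Y12 X Y : Module.End ℂ (CN N))
    (hX1 : IsUnit X1) (hX2 : IsUnit X2) (hX12 : IsUnit X12) :
    LinearMap.range (phiL N (CGsub N X1 Y1 X2 Y2 X12 Y12) (CGsub N X12 Y12 X3 Y3 X Y)) ≤
    HW N X Y (TensorProduct.map X1 (TensorProduct.map X2 X3))
      (TensorProduct.map (Ring.inverse X1)
        (TensorProduct.map (Ring.inverse X2) Y3 + TensorProduct.map Y2 1)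
        + TensorProduct.map Y1 1) := by
  rintro _ ⟨t, rfl⟩
  induction t using TensorProduct.induction_on with
  | zero => rw [map_zero]; exact Submodule.zero_mem _
  | add a b ha hb => rw [map_add]; exact Submodule.add_mem _ ha hb
  | tmul f g =>
    obtain ⟨f, hf1, hf2⟩ := f
    obtain ⟨g, hg1, hg2⟩ := g
    have hfi : f ∘ₗ Ring.inverse X12
        = TensorProduct.map (Ring.inverse X1) (Ring.inverse X2) ∘ₗ f := by
      have a1 : X12 ∘ₗ Ring.inverse X12 = LinearMap.id := Ring.mul_inverse_cancel _ hX12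
      have a2 : Ring.inverse X1 ∘ₗ X1 = LinearMap.id := Ring.inverse_mul_cancel _ hX1
      have a3 : Ring.inverse X2 ∘ₗ X2 = LinearMap.id := Ring.inverse_mul_cancel _ hX2
      calc f ∘ₗ Ring.inverse X12
          = TensorProduct.map (Ring.inverse X1) (Ring.inverse X2) ∘ₗ
            (TensorProduct.map X1 X2 ∘ₗ f) ∘ₗ Ring.inverse X12 := by
            rw [LinearMap.comp_assoc, ← LinearMap.comp_assoc _ (TensorProduct.map X1 X2),
              ← TensorProduct.map_comp, a2, a3, TensorProduct.map_id, LinearMap.id_comp]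
        _ = _ := by rw [← hf1, LinearMap.comp_assoc, a1, LinearMap.comp_id]
    have as : ∀ P Q S : Module.End ℂ (CN N),
        (TensorProduct.assoc ℂ (CN N) (CN N) (CN N)).toLinearMap ∘ₗ
          TensorProduct.map (TensorProduct.map P Q) S =
        TensorProduct.map P (TensorProduct.map Q S) ∘ₗ
          (TensorProduct.assoc ℂ (CN N) (CN N) (CN N)).toLinearMap := by
      intro P Q S
      exact TensorProduct.ext_threefold fun a b c => by simp
    change (TensorProduct.assoc ℂ (CN N) (CN N) (CN N)).toLinearMap ∘ₗ
      (TensorProduct.map f LinearMap.id) ∘ₗ g ∈ _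
    constructor
    · have e : TensorProduct.map f LinearMap.id ∘ₗ TensorProduct.map X12 X3
          = TensorProduct.map (TensorProduct.map X1 X2) X3 ∘ₗ TensorProduct.map f LinearMap.id := by
        rw [← TensorProduct.map_comp, ← TensorProduct.map_comp, hf1]
        rfl
      rw [LinearMap.comp_assoc, LinearMap.comp_assoc, hg1, ← LinearMap.comp_assoc g, e,
        LinearMap.comp_assoc g, ← LinearMap.comp_assoc, as]
      rfl
    · have e : TensorProduct.map f LinearMap.id ∘ₗ
          (TensorProduct.map (Ring.inverse X12) Y3 + TensorProduct.map Y12 1)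
          = (TensorProduct.map (TensorProduct.map (Ring.inverse X1) (Ring.inverse X2)) Y3
            + TensorProduct.map (TensorProduct.map (Ring.inverse X1) Y2) 1
            + TensorProduct.map (TensorProduct.map Y1 1) 1) ∘ₗ TensorProduct.map f LinearMap.id := by
        rw [LinearMap.comp_add, LinearMap.add_comp, LinearMap.add_comp]
        simp only [← TensorProduct.map_comp]
        rw [hfi, hf2, LinearMap.add_comp, TensorProduct.map_add_left, add_assoc]
        rfl
      have e2 : (TensorProduct.assoc ℂ (CN N) (CN N) (CN N)).toLinearMap ∘ₗ
          (TensorProduct.map (TensorProduct.map (Ring.inverse X1) (Ring.inverse X2)) Y3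
            + TensorProduct.map (TensorProduct.map (Ring.inverse X1) Y2) 1
            + TensorProduct.map (TensorProduct.map Y1 1) 1)
          = (TensorProduct.map (Ring.inverse X1)
            (TensorProduct.map (Ring.inverse X2) Y3 + TensorProduct.map Y2 1)
            + TensorProduct.map Y1 1) ∘ₗ
            (TensorProduct.assoc ℂ (CN N) (CN N) (CN N)).toLinearMap := by
        rw [LinearMap.comp_add, LinearMap.comp_add, as, as, as, TensorProduct.map_add_right,
          LinearMap.add_comp, LinearMap.add_comp, TensorProduct.map_one]
      rw [LinearMap.comp_assoc, LinearMap.comp_assoc, hg2, ← LinearMap.comp_assoc g, e,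
        LinearMap.comp_assoc g, ← LinearMap.comp_assoc, e2]
      rfl

/-- for a regular triple (μ,ν,σ) there is a unique linear map
R : V_{(μ,ν)} ⊗ V_{(μν,σ)} → V_{(μ,νσ)} ⊗ V_{(ν,σ)} (Kashaev's 6j-symbol) with
(Id⊗g_i)∘f_i summed over R(f⊗g) = Σ f_i⊗g_i equal to (f⊗Id)∘g, i.e.
Ψ ∘ R = Φ; moreover R is a linear isomorphism. -/
theorem stmt11 (N : ℕ) (hN : 1 ≤ N) (q : ℂ) (hq : IsPrimitiveRoot (q ^ 2) N)
    (u1 v1 u2 v2 u3 v3 u12 v12 u23 v23 u123 v123 : ℂ)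
    (hu1 : u1 ≠ 0) (hv1 : v1 ≠ 0) (hu2 : u2 ≠ 0) (hv2 : v2 ≠ 0)
    (hu3 : u3 ≠ 0) (hv3 : v3 ≠ 0) (hu12 : u12 ≠ 0) (hv12 : v12 ≠ 0)
    (hu23 : u23 ≠ 0) (hv23 : v23 ≠ 0) (hu123 : u123 ≠ 0) (hv123 : v123 ≠ 0)
    (hreg1 : (u1 ^ N)⁻¹ * v2 ^ N + v1 ^ N ≠ 0)
    (hreg2 : (u2 ^ N)⁻¹ * v3 ^ N + v2 ^ N ≠ 0)
    (hreg3 : (u1 ^ N * u2 ^ N)⁻¹ * v3 ^ N + (u1 ^ N)⁻¹ * v2 ^ N + v1 ^ N ≠ 0)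
    (hx12 : u12 ^ N = u1 ^ N * u2 ^ N) (hy12 : v12 ^ N = (u1 ^ N)⁻¹ * v2 ^ N + v1 ^ N)
    (hx23 : u23 ^ N = u2 ^ N * u3 ^ N) (hy23 : v23 ^ N = (u2 ^ N)⁻¹ * v3 ^ N + v2 ^ N)
    (hx123 : u123 ^ N = u1 ^ N * u2 ^ N * u3 ^ N)
    (hy123 : v123 ^ N = (u1 ^ N * u2 ^ N)⁻¹ * v3 ^ N + (u1 ^ N)⁻¹ * v2 ^ N + v1 ^ N) :
    let Xμ := u1 • opA q N; let Yμ := v1 • opB N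
    let Xν := u2 • opA q N; let Yν := v2 • opB N
    let Xσ := u3 • opA q N; let Yσ := v3 • opB N
    let Xμν := u12 • opA q N; let Yμν := v12 • opB N
    let Xνσ := u23 • opA q N; let Yνσ := v23 • opB N
    let Xμνσ := u123 • opA q N; let Yμνσ := v123 • opB N
    let CG1 := CGsub N Xμ Yμ Xν Yν Xμν Yμν          -- V_{(μ,ν)}
    let CG2 := CGsub N Xμν Yμν Xσ Yσ Xμνσ Yμνσ      -- V_{(μν,σ)}
    let CG1' := CGsub N Xμ Yμ Xνσ Yνσ Xμνσ Yμνσ     -- V_{(μ,νσ)}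
    let CG2' := CGsub N Xν Yν Xσ Yσ Xνσ Yνσ         -- V_{(ν,σ)}
    ∃ R : (CG1 ⊗[ℂ] CG2) →ₗ[ℂ] (CG1' ⊗[ℂ] CG2'),
      (psiL N CG1' CG2') ∘ₗ R = phiL N CG1 CG2 ∧
      Function.Bijective R ∧
      ∀ R' : (CG1 ⊗[ℂ] CG2) →ₗ[ℂ] (CG1' ⊗[ℂ] CG2'),
        (psiL N CG1' CG2') ∘ₗ R' = phiL N CG1 CG2 → R' = R := by
  intro Xμ Yμ Xν Yν Xσ Yσ Xμν Yμν Xνσ Yνσ Xμνσ Yμνσ CG1 CG2 CG1' CG2'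
  have : NeZero N := ⟨by omega⟩
  have W1 : WD N (q ^ 2) (u1 ^ N) (v1 ^ N) Xμ Yμ := std_WD hq u1 v1
  have W2 : WD N (q ^ 2) (u2 ^ N) (v2 ^ N) Xν Yν := std_WD hq u2 v2
  have W3 : WD N (q ^ 2) (u3 ^ N) (v3 ^ N) Xσ Yσ := std_WD hq u3 v3
  have W12 : WD N (q ^ 2) (u12 ^ N) (v12 ^ N) Xμν Yμν := std_WD hq u12 v12
  have W23 : WD N (q ^ 2) (u23 ^ N) (v23 ^ N) Xνσ Yνσ := std_WD hq u23 v23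
  have p1 : u1 ^ N ≠ 0 := pow_ne_zero _ hu1
  have p2 : u2 ^ N ≠ 0 := pow_ne_zero _ hu2
  have p12 : u12 ^ N ≠ 0 := pow_ne_zero _ hu12
  have T1 := W1.tensor hN hq p1 W2
  have T2 := W12.tensor hN hq p12 W3
  have T1' := W1.tensor hN hq p1 W23
  have T2' := W2.tensor hN hq p2 W3
  have T3 := W1.tensor hN hq p1 T2'
  rw [← hx12, ← hy12] at T1
  rw [show u12 ^ N * u3 ^ N = u123 ^ N by rw [hx12, hx123],
    show (u12 ^ N)⁻¹ * v3 ^ N + v12 ^ N = v123 ^ N by rw [hx12, hy12, hy123, add_assoc]] at T2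
  rw [← hx23, ← hy23] at T2'
  have ex : u1 ^ N * u23 ^ N = u123 ^ N := by rw [hx23, hx123, mul_assoc]
  have ey : (u1 ^ N)⁻¹ * v23 ^ N + v1 ^ N = v123 ^ N := by
    rw [hy23, hy123, mul_inv, mul_add, mul_assoc]
  rw [ex, ey] at T1'
  rw [← hx23, ← hy23, ex, ey] at T3
  have i1 : Function.Injective (ev CG1) := ev_inj hq hu12 hv12
  have i2 : Function.Injective (ev0 CG2) := ev0_inj hv123
  have i1' : Function.Injective (ev0 CG1') := ev0_inj hv123
  have i2' : Function.Injective (ev CG2') := ev_inj hq hu23 hv23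
  have hphi := phi_inj CG1 CG2 i1 i2
  have hpsi := psi_inj CG1' CG2' i1' i2'
  have dd : Module.finrank ℂ (CN N ⊗[ℂ] CN N) = N * N := by
    rw [Module.finrank_tensorProduct]; simp [ZMod.card]
  have dd3 : Module.finrank ℂ (CN N ⊗[ℂ] (CN N ⊗[ℂ] CN N)) = N * (N * N) := by
    rw [Module.finrank_tensorProduct, dd]; simp [ZMod.card]
  have cancel : ∀ a b : ℕ, a * N = b * N → a = b := fun a b h =>
    Nat.eq_of_mul_eq_mul_right (by omega) h
  have d1 : Module.finrank ℂ CG1 = N := cancel _ _ ((HW_finrank hq hu12 hv12 T1).trans dd)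
  have d2 : Module.finrank ℂ CG2 = N := cancel _ _ ((HW_finrank hq hu123 hv123 T2).trans dd)
  have d1' : Module.finrank ℂ CG1' = N := cancel _ _ ((HW_finrank hq hu123 hv123 T1').trans dd)
  have d2' : Module.finrank ℂ CG2' = N := cancel _ _ ((HW_finrank hq hu23 hv23 T2').trans dd)
  have d3 := cancel _ (N * N) ((HW_finrank hq hu123 hv123 T3).trans (dd3.trans (by ring)))
  have r1 := phi_range_le N Xμ Yμ Xν Yν Xσ Yσ Xμν Yμν Xμνσ Yμνσ (W1.isUnit hN p1)
    (W2.isUnit hN p2) (W12.isUnit hN p12)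
  have r2 := psi_range_le N Xμ Yμ Xν Yν Xσ Yσ Xνσ Yνσ Xμνσ Yμνσ
  have n1 : Module.finrank ℂ (CG1 ⊗[ℂ] CG2) = N * N :=
    (finrank_sub_tensor CG1 CG2).trans (by rw [d1, d2])
  have n2 : Module.finrank ℂ (CG1' ⊗[ℂ] CG2') = N * N :=
    (finrank_sub_tensor CG1' CG2').trans (by rw [d1', d2'])
  have q1 := range_eq_of (phiL N CG1 CG2) _ hphi r1 (n1.trans d3.symm)
  have q2 := range_eq_of (psiL N CG1' CG2') _ hpsi r2 (n2.trans d3.symm)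
  exact exists_R (phiL N CG1 CG2) (psiL N CG1' CG2') hphi hpsi (q1.trans q2.symm)

end
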